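/- arXiv:2010.13315 — 2 statements merged into one kernel-verified Lean document; each statement's English description precedes it below -/
import Mathlib

section
/- Let N ≥ 5, max{-4, -N/2} < 2b < 0 and 3/2 ≤ q < q^* := 1 + (4+2b)/(N-4). Then there exists C > 0, depending only on N, q, b, such that for every Schwartz function u : ℝ^N → ℂ, ∫_{ℝ^N} |x|^{2b} |u(x)|^{2q-1} dx ≤ C ‖u‖_{H²}^{2q-1}. -/
open MeasureTheory Filter Complex SchwartzMap
open scoped FourierTransform ENNReal NNReal

noncomputable section

/-- `N`-dimensional Euclidean space. -/
abbrev EV (N : ℕ) := EuclideanSpace ℝ (Fin N)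

/-- Partial derivative in the `j`-th coordinate direction. -/
def pd {N : ℕ} {F : Type*} [NormedAddCommGroup F] [NormedSpace ℝ F]
    (j : Fin N) (f : EV N → F) : EV N → F :=
  fun x => fderiv ℝ f x (EuclideanSpace.single j 1)

/-- The Laplacian, as the sum of the second partial derivatives. -/
def lap {N : ℕ} {F : Type*} [NormedAddCommGroup F] [NormedSpace ℝ F]
    (f : EV N → F) : EV N → F :=
  fun x => ∑ j : Fin N, pd j (pd j f) x

/-- The mass `∫ |f|²`. -/
def massI {N : ℕ} (f : EV N → ℂ) : ℝ := ∫ x : EV N, ‖f x‖ ^ 2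

/-- The `L²` norm. -/
def L2 {N : ℕ} (f : EV N → ℂ) : ℝ := (massI f) ^ ((1 : ℝ)/2)

/-- The `H²` norm `(‖f‖₂² + ‖Δf‖₂²)^(1/2)`. -/
def H2n {N : ℕ} (f : EV N → ℂ) : ℝ := ((L2 f) ^ 2 + (L2 (lap f)) ^ 2) ^ ((1 : ℝ)/2)

open LineDeriv Laplacian in
theorem lap_eq_laplacian {N : ℕ} (u : SchwartzMap (EV N) ℂ) : lap ⇑u = ⇑(Δ u : SchwartzMap (EV N) ℂ) := by
  have h (j : Fin N) (f : SchwartzMap (EV N) ℂ) :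
      pd j ⇑f =
      ⇑(∂_{(EuclideanSpace.single j (1 : ℝ) : EV N)} f : SchwartzMap (EV N) ℂ) := by
    ext x
    simp [pd, SchwartzMap.lineDerivOp_apply_eq_fderiv]
  ext x
  rw [SchwartzMap.laplacian_eq_sum (EuclideanSpace.basisFun (Fin N) ℝ)]
  simp [lap, h]

open Laplacian in
/-- The Fourier symbol of the Laplacian. -/
theorem fourier_laplacian_apply {N : ℕ} (u : SchwartzMap (EV N) ℂ) (ξ : EV N) :
    𝓕 (Δ u) ξ = -(2 * (Real.pi : ℂ)) ^ 2 * (‖ξ‖ ^ 2 * 𝓕 u ξ) := by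
  have hg : Function.HasTemperateGrowth ((‖·‖ ^ 2 : EV N → ℝ)) := by
    change Function.HasTemperateGrowth (fun x : EV N => ‖x‖ ^ 2)
    fun_prop
  rw [SchwartzMap.laplacian_eq_fourierMultiplierCLM, SchwartzMap.fourierMultiplierCLM_apply,
    FourierTransform.fourier_smul, FourierTransform.fourier_fourierInv_eq]
  simp [SchwartzMap.smulLeftCLM_apply_apply hg]

theorem massI_nonneg {N : ℕ} (f : EV N → ℂ) : 0 ≤ massI f :=
  integral_nonneg fun _ => by positivity

theorem H2n_nonneg {N : ℕ} (f : EV N → ℂ) : 0 ≤ H2n f := by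
  unfold H2n
  positivity

theorem H2n_sq {N : ℕ} (f : EV N → ℂ) : H2n f ^ 2 = massI f + massI (lap f) := by
  have h (g : ℝ) (hg : 0 ≤ g) : (g ^ ((1 : ℝ) / 2)) ^ 2 = g := by
    rw [← Real.sqrt_eq_rpow, Real.sq_sqrt hg]
  unfold H2n
  rw [h _ (by positivity), L2, L2, h _ (massI_nonneg _), h _ (massI_nonneg _)]

theorem integrable_norm_sq {N : ℕ} (f : SchwartzMap (EV N) ℂ) :
    Integrable (fun x => ‖f x‖ ^ 2) :=
  (memLp_two_iff_integrable_sq_norm f.continuous.aestronglyMeasurable).1 (f.memLp 2 volume)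

/-- The homogeneous second-order Sobolev norm on the Fourier side is controlled by `H2n`. -/
theorem integral_norm_pow_four_fourier_le {N : ℕ} (u : SchwartzMap (EV N) ℂ) :
    Integrable (fun ξ => ‖ξ‖ ^ 4 * ‖𝓕 u ξ‖ ^ 2) ∧
      ∫ ξ, ‖ξ‖ ^ 4 * ‖𝓕 u ξ‖ ^ 2 ≤ H2n ⇑u ^ 2 := by
  have key : (fun ξ => ‖ξ‖ ^ 4 * ‖𝓕 u ξ‖ ^ 2) =
      fun ξ => ((2 * Real.pi) ^ 4)⁻¹ * ‖𝓕 (Laplacian.laplacian u) ξ‖ ^ 2 := by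
    ext ξ
    rw [fourier_laplacian_apply]
    have := Real.pi_pos
    simp only [norm_mul, norm_neg, norm_pow, Complex.norm_real, norm_norm, Complex.norm_ofNat,
      Real.norm_of_nonneg this.le]
    field_simp
  rw [key]
  refine ⟨(integrable_norm_sq _).const_mul _, ?_⟩
  rw [integral_const_mul, SchwartzMap.integral_norm_sq_fourier, H2n_sq, lap_eq_laplacian]
  have h1 : ((2 * Real.pi) ^ 4)⁻¹ ≤ 1 := by
    apply inv_le_one_of_one_le₀
    apply one_le_pow₀
    linarith [Real.pi_gt_three]
  have h2 : 0 ≤ massI ⇑(Laplacian.laplacian u) := massI_nonneg _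
  change _ * massI ⇑(Laplacian.laplacian u) ≤ _
  nlinarith [massI_nonneg ⇑u]

/-- Power weights are integrable on balls, with the expected scaling in the radius. -/
theorem exists_integral_ball_norm_rpow {N : ℕ} (hN : 1 ≤ N) {σ : ℝ} (hσ : -(N : ℝ) < σ) :
    ∃ c > 0, ∀ r > 0, IntegrableOn (fun x : EV N => ‖x‖ ^ σ) (Metric.ball 0 r) ∧
      ∫ x in Metric.ball (0 : EV N) r, ‖x‖ ^ σ ≤ c * r ^ ((N : ℝ) + σ) := by
  set I := ∫ x in Metric.ball (0 : EV N) 1, ‖x‖ ^ σ with hI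
  have hI0 : 0 ≤ I := integral_nonneg fun _ => by positivity
  refine ⟨I + 1, by positivity, fun r hr => ⟨?_, ?_⟩⟩
  · apply integrableOn_ball_of_norm_le_rpow (C := 1) (α := -σ) (by simpa using hN)
      (by simpa using by linarith)
    · refine .of_forall fun x => ?_
      rw [Real.norm_of_nonneg (by positivity)]
      simp
    · exact (measurable_norm.pow_const σ).aestronglyMeasurable
  · have h := Measure.setIntegral_comp_smul_of_pos (volume : Measure (EV N))
      (fun x => ‖x‖ ^ σ) (Metric.ball 0 1) hr
    rw [smul_unitBall_of_pos hr] at h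
    simp only [norm_smul, Real.norm_of_nonneg hr.le, finrank_euclideanSpace, Fintype.card_fin,
      smul_eq_mul, Real.mul_rpow hr.le (norm_nonneg _), integral_const_mul] at h
    rw [← hI] at h
    have h2 : ∫ x in Metric.ball (0 : EV N) r, ‖x‖ ^ σ = r ^ ((N : ℝ) + σ) * I := by
      rw [Real.rpow_add hr, Real.rpow_natCast, mul_assoc, h]
      field_simp
    rw [h2]
    have := Real.rpow_pos_of_pos hr ((N : ℝ) + σ)
    nlinarith

theorem norm_fourierInv_le {N : ℕ} (v : SchwartzMap (EV N) ℂ) (x : EV N) :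
    ‖𝓕⁻ v x‖ ≤ ∫ ξ, ‖v ξ‖ := by
  rw [SchwartzMap.fourierInv_coe, Real.fourierInv_eq]
  refine (norm_integral_le_integral_norm _).trans_eq ?_
  simp

/-- Splitting into a bounded low-frequency part and a square-integrable high-frequency part. -/
theorem exists_frequency_splitting {N : ℕ} (hN : 5 ≤ N) :
    ∃ C > 0, ∀ u : SchwartzMap (EV N) ℂ, 0 < H2n ⇑u → ∀ A > 0,
      ∃ l h : SchwartzMap (EV N) ℂ, u = l + h ∧
        (∀ x, ‖l x‖ ≤ C * H2n ⇑u * A ^ (((N : ℝ) - 4) / 2)) ∧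
        ∫ x, ‖h x‖ ^ 2 ≤ (A ^ 4)⁻¹ * H2n ⇑u ^ 2 := by
  have hN' : (5 : ℝ) ≤ N := by exact_mod_cast hN
  obtain ⟨c, hc, hW⟩ := exists_integral_ball_norm_rpow (N := N) (by omega) (σ := -4) (by linarith)
  set e := ((N : ℝ) - 4) / 2 with he
  refine ⟨1 + c * 2 ^ (2 * e), by positivity, fun u hM A hA => ?_⟩
  obtain ⟨hint, hle⟩ := integral_norm_pow_four_fourier_le u
  set M := H2n ⇑u
  let φ : ContDiffBump (0 : EV N) := ⟨A, 2 * A, hA, by linarith⟩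
  have hsupp : HasCompactSupport (fun ξ => (φ ξ : ℂ) * 𝓕 u ξ) :=
    HasCompactSupport.mul_right (φ.hasCompactSupport.comp_left (g := Complex.ofReal) (by simp))
  have hsm : ContDiff ℝ ((⊤ : ℕ∞) : WithTop ℕ∞) (fun ξ => (φ ξ : ℂ) * 𝓕 u ξ) :=
    (Complex.ofRealCLM.contDiff.comp φ.contDiff).mul ((𝓕 u).smooth _)
  set v := hsupp.toSchwartzMap hsm
  have hv (ξ : EV N) : v ξ = (φ ξ : ℂ) * 𝓕 u ξ := rfl
  refine ⟨𝓕⁻ v, u - 𝓕⁻ v, by simp, fun x => ?_, ?_⟩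
  · refine (norm_fourierInv_le v x).trans ?_
    obtain ⟨hWi, hWle⟩ := hW (2 * A) (by positivity)
    set L := A ^ e / M
    have hL : 0 < L := by positivity
    have hi : Integrable (fun ξ => L * (‖ξ‖ ^ 4 * ‖𝓕 u ξ‖ ^ 2) +
        L⁻¹ * (Metric.ball (0 : EV N) (2 * A)).indicator (fun ξ => ‖ξ‖ ^ (-4 : ℝ)) ξ) :=
      (hint.const_mul _).add
        (((integrable_indicator_iff Metric.isOpen_ball.measurableSet).2 hWi).const_mul _)
    have : Nonempty (Fin N) := ⟨⟨0, by omega⟩⟩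
    have hpt : ∀ᵐ ξ : EV N, ‖v ξ‖ ≤ L * (‖ξ‖ ^ 4 * ‖𝓕 u ξ‖ ^ 2) +
        L⁻¹ * (Metric.ball (0 : EV N) (2 * A)).indicator (fun ξ => ‖ξ‖ ^ (-4 : ℝ)) ξ := by
      filter_upwards [compl_mem_ae_iff.2 (measure_singleton (0 : EV N))] with ξ hξ
      have hξ0 : 0 < ‖ξ‖ := norm_pos_iff.2 hξ
      by_cases hb : ξ ∈ Metric.ball (0 : EV N) (2 * A)
      · rw [Set.indicator_of_mem hb, hv, norm_mul, Complex.norm_real,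
          Real.norm_of_nonneg φ.nonneg]
        have h1 : φ ξ * ‖𝓕 u ξ‖ ≤ ‖𝓕 u ξ‖ := mul_le_of_le_one_left (norm_nonneg _) φ.le_one
        have h2 : ‖ξ‖ ^ (-4 : ℝ) = (‖ξ‖ ^ 4)⁻¹ := by
          rw [Real.rpow_neg hξ0.le]
          norm_cast
        rw [h2]
        refine h1.trans ?_
        set y := ‖𝓕 u ξ‖
        have hy : 0 ≤ y := norm_nonneg _
        set D := L * ‖ξ‖ ^ 4
        have hD : 0 < D := by positivity
        have h3 : L * (‖ξ‖ ^ 4 * y ^ 2) + L⁻¹ * (‖ξ‖ ^ 4)⁻¹ = D * y ^ 2 + D⁻¹ := by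
          simp only [D, mul_inv]
          ring
        rw [h3]
        have h4 : D * y ^ 2 + D⁻¹ - y = D⁻¹ * ((D * y - 1 / 2) ^ 2 + 3 / 4) := by
          field_simp
          ring
        have : 0 ≤ D⁻¹ * ((D * y - 1 / 2) ^ 2 + 3 / 4) := by positivity
        linarith
      · rw [Set.indicator_of_notMem hb, hv, φ.zero_of_le_dist (by simpa [φ] using hb)]
        simp only [Complex.ofReal_zero, zero_mul, norm_zero, mul_zero, add_zero]
        positivity
    refine (integral_mono_ae v.integrable.norm hi hpt).trans ?_
    rw [integral_add (hint.const_mul _)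
      (((integrable_indicator_iff Metric.isOpen_ball.measurableSet).2 hWi).const_mul _),
      integral_const_mul, integral_const_mul, integral_indicator Metric.isOpen_ball.measurableSet]
    calc _ ≤ L * M ^ 2 + L⁻¹ * (c * (2 * A) ^ ((N : ℝ) + -4)) := by gcongr
      _ = _ := by
        have h5 : (N : ℝ) + -4 = 2 * e := by rw [he]; ring
        have h6 : A ^ (2 * e) = A ^ e * A ^ e := by rw [← Real.rpow_add hA]; ring_nf
        have h7 : 0 < A ^ e := by positivity
        rw [h5, Real.mul_rpow (by norm_num) hA.le, h6]
        simp only [L]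
        field_simp
  · rw [← SchwartzMap.integral_norm_sq_fourier]
    have h1 : 𝓕 (u - 𝓕⁻ v) = 𝓕 u - v := by
      rw [sub_eq_add_neg, FourierTransform.fourier_add, FourierTransform.fourier_neg,
        FourierTransform.fourier_fourierInv_eq, sub_eq_add_neg]
    have hpt (ξ : EV N) : ‖(𝓕 (u - 𝓕⁻ v)) ξ‖ ^ 2 ≤ (A ^ 4)⁻¹ * (‖ξ‖ ^ 4 * ‖𝓕 u ξ‖ ^ 2) := by
      rw [h1, sub_apply, hv]
      by_cases hb : ξ ∈ Metric.closedBall (0 : EV N) A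
      · rw [φ.one_of_mem_closedBall hb]
        simp only [Complex.ofReal_one, one_mul, sub_self, norm_zero, ne_eq,
          OfNat.ofNat_ne_zero, not_false_eq_true, zero_pow]
        positivity
      · have h2 : A < ‖ξ‖ := by simpa using hb
        have h3 : 𝓕 u ξ - (φ ξ : ℂ) * 𝓕 u ξ = ((1 - φ ξ : ℝ) : ℂ) * 𝓕 u ξ := by
          push_cast
          ring
        have h4 : 0 ≤ 1 - φ ξ := sub_nonneg.2 φ.le_one
        have h5 : 1 ≤ (A ^ 4)⁻¹ * ‖ξ‖ ^ 4 := by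
          rw [← div_eq_inv_mul, one_le_div (by positivity)]
          gcongr
        rw [h3, norm_mul, Complex.norm_real, Real.norm_of_nonneg h4, ← mul_assoc]
        have h6 : (1 - φ ξ) * ‖𝓕 u ξ‖ ≤ ‖𝓕 u ξ‖ :=
          mul_le_of_le_one_left (norm_nonneg _) (by linarith [φ.nonneg (x := ξ)])
        calc _ ≤ ‖𝓕 u ξ‖ ^ 2 := by gcongr
          _ ≤ _ := le_mul_of_one_le_left (by positivity) h5
    refine (integral_mono (integrable_norm_sq _) (hint.const_mul _) hpt).trans ?_
    rw [integral_const_mul]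
    gcongr

/-- Chebyshev's inequality for Schwartz functions. -/
theorem volume_lt_norm_le {N : ℕ} (f : SchwartzMap (EV N) ℂ) {t : ℝ} (ht : 0 < t) :
    volume {x | t < ‖f x‖} ≤ ENNReal.ofReal ((t ^ 2)⁻¹ * ∫ x, ‖f x‖ ^ 2) := by
  have hm := meas_ge_le_lintegral_div (μ := (volume : Measure (EV N)))
    (f := fun x => ENNReal.ofReal (‖f x‖ ^ 2)) (ε := ENNReal.ofReal (t ^ 2))
    (by have := f.continuous; fun_prop) (by simpa using ht.ne') ENNReal.ofReal_ne_top
  rw [← ofReal_integral_eq_lintegral_ofReal (integrable_norm_sq f)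
    (.of_forall fun _ => by positivity), ← ENNReal.ofReal_div_of_pos (by positivity),
    div_eq_inv_mul] at hm
  refine (measure_mono fun x hx => ?_).trans hm
  have hx' : t < ‖f x‖ := hx
  exact ENNReal.ofReal_le_ofReal (by gcongr)

/-- The weak-type critical Sobolev inequality. -/
theorem exists_volume_lt_norm_le {N : ℕ} (hN : 5 ≤ N) :
    ∃ K > 0, ∀ u : SchwartzMap (EV N) ℂ, 0 < H2n ⇑u → ∀ t > 0,
      volume {x | t < ‖u x‖} ≤
        ENNReal.ofReal (K * (H2n ⇑u / t) ^ (2 * (N : ℝ) / ((N : ℝ) - 4))) := by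
  obtain ⟨C, hC, hsplit⟩ := exists_frequency_splitting hN
  have hN' : (0 : ℝ) < (N : ℝ) - 4 := by
    have : (5 : ℝ) ≤ N := by exact_mod_cast hN
    linarith
  refine ⟨4 * (2 * C) ^ (8 / ((N : ℝ) - 4)), by positivity, fun u hM t ht => ?_⟩
  set M := H2n ⇑u
  set A := (t / (2 * C * M)) ^ (2 / ((N : ℝ) - 4)) with hA
  have hA0 : 0 < A := by positivity
  obtain ⟨l, h, hu, hl, hh⟩ := hsplit u hM A hA0
  have hA1 : A ^ (((N : ℝ) - 4) / 2) = t / (2 * C * M) := by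
    rw [hA, ← Real.rpow_mul (by positivity)]
    have : 2 / ((N : ℝ) - 4) * (((N : ℝ) - 4) / 2) = 1 := by field_simp
    rw [this, Real.rpow_one]
  have hsub : {x | t < ‖u x‖} ⊆ {x | t / 2 < ‖h x‖} := by
    intro x hx
    have h1 : t < ‖u x‖ := hx
    have h2 := hl x
    have h3 : C * M * (t / (2 * C * M)) = t / 2 := by field_simp
    rw [hA1, h3] at h2
    have h4 : ‖u x‖ ≤ ‖l x‖ + ‖h x‖ := by
      rw [hu]
      exact norm_add_le _ _
    change t / 2 < ‖h x‖
    linarith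
  refine (measure_mono hsub).trans ((volume_lt_norm_le h (half_pos ht)).trans ?_)
  apply ENNReal.ofReal_le_ofReal
  calc _ ≤ ((t / 2) ^ 2)⁻¹ * ((A ^ 4)⁻¹ * M ^ 2) := by gcongr
    _ = _ := by
      have h1 : (A ^ 4)⁻¹ = (2 * C) ^ (8 / ((N : ℝ) - 4)) * (M / t) ^ (8 / ((N : ℝ) - 4)) := by
        rw [hA, ← Real.rpow_natCast, ← Real.rpow_mul (by positivity),
          ← Real.inv_rpow (by positivity), ← Real.mul_rpow (by positivity) (by positivity)]
        congr 1
        · field_simp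
        · push_cast
          ring
      have h2 : (M / t) ^ (2 * (N : ℝ) / ((N : ℝ) - 4)) =
          (M / t) ^ (8 / ((N : ℝ) - 4)) * (M / t) ^ 2 := by
        rw [← Real.rpow_natCast, ← Real.rpow_add (by positivity)]
        congr 1
        push_cast
        field_simp
        ring
      rw [h1, h2]
      field_simp
      ring

/-- The measure with density `‖x‖ ^ σ`. -/
def powerWeight (N : ℕ) (σ : ℝ) : Measure (EV N) :=
  volume.withDensity fun x => ENNReal.ofReal (‖x‖ ^ σ)

/-- Sets of Lebesgue measure `O(r ^ N)` have weighted measure `O(r ^ (N + σ))` when `σ ≤ 0`. -/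
theorem exists_powerWeight_le {N : ℕ} (hN : 1 ≤ N) {σ : ℝ} (hσ : -(N : ℝ) < σ) (hσ' : σ ≤ 0) :
    ∃ c > 0, ∀ K ≥ 0, ∀ r > 0, ∀ E : Set (EV N), MeasurableSet E →
      volume E ≤ ENNReal.ofReal (K * r ^ (N : ℝ)) →
      powerWeight N σ E ≤ ENNReal.ofReal ((c + K) * r ^ ((N : ℝ) + σ)) := by
  obtain ⟨c, hc, hW⟩ := exists_integral_ball_norm_rpow hN hσ
  refine ⟨c, hc, fun K hK r hr E hE hvol => ?_⟩
  obtain ⟨hi, hle⟩ := hW r hr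
  have hB : MeasurableSet (Metric.ball (0 : EV N) r) := Metric.isOpen_ball.measurableSet
  rw [← Set.inter_union_sdiff E (Metric.ball (0 : EV N) r)]
  refine (measure_union_le _ _).trans ?_
  rw [add_mul, ENNReal.ofReal_add (by positivity) (by positivity)]
  refine add_le_add ?_ ?_
  · refine (measure_mono Set.inter_subset_right).trans ?_
    rw [powerWeight, withDensity_apply _ hB, ← ofReal_integral_eq_lintegral_ofReal hi
      (.of_forall fun _ => by positivity)]
    exact ENNReal.ofReal_le_ofReal hle
  · rw [powerWeight, withDensity_apply _ (hE.diff hB)]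
    calc _ ≤ ∫⁻ _ in E \ Metric.ball (0 : EV N) r, ENNReal.ofReal (r ^ σ) := by
          refine setLIntegral_mono' (hE.diff hB) fun x hx => ?_
          apply ENNReal.ofReal_le_ofReal
          exact Real.rpow_le_rpow_of_nonpos hr (by simpa using hx.2) hσ'
      _ ≤ ENNReal.ofReal (r ^ σ) * ENNReal.ofReal (K * r ^ (N : ℝ)) := by
          rw [setLIntegral_const]
          gcongr
          exact (measure_mono Set.sdiff_subset).trans hvol
      _ = _ := by
          rw [← ENNReal.ofReal_mul (by positivity), Real.rpow_add hr]
          congr 1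
          ring

/-- A function with polynomially decaying distribution function, of order `α < p` below the
height `M` and `β > p` above it, lies in `L^p`. -/
theorem lintegral_rpow_le_of_meas_lt_le {X : Type*} [MeasurableSpace X] (ν : Measure X)
    {f : X → ℝ} (hf : Measurable f) (hf0 : ∀ x, 0 ≤ f x) {p α β D M : ℝ} (hp : 0 < p)
    (hα : α < p) (hβ : p < β) (hD : 0 ≤ D) (hM : 0 < M)
    (hlow : ∀ t > 0, ν {x | t < f x} ≤ ENNReal.ofReal (D * (M / t) ^ α))
    (hhigh : ∀ t > 0, ν {x | t < f x} ≤ ENNReal.ofReal (D * (M / t) ^ β)) :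
    ∫⁻ x, ENNReal.ofReal (f x ^ p) ∂ν ≤
      ENNReal.ofReal (p * (D * ((p - α)⁻¹ + (β - p)⁻¹)) * M ^ p) := by
  have hpt (γ t : ℝ) (ht : 0 < t) (h : ν {x | t < f x} ≤ ENNReal.ofReal (D * (M / t) ^ γ)) :
      ν {x | t < f x} * ENNReal.ofReal (t ^ (p - 1)) ≤
        ENNReal.ofReal (D * M ^ γ * t ^ (p - 1 - γ)) := by
    calc _ ≤ ENNReal.ofReal (D * (M / t) ^ γ) * ENNReal.ofReal (t ^ (p - 1)) := by gcongr
      _ = _ := by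
        rw [← ENNReal.ofReal_mul (by positivity), Real.div_rpow hM.le ht.le,
          Real.rpow_sub ht (p - 1) γ]
        congr 1
        field_simp
  have hL : ∫⁻ t in Set.Ioc 0 M, ν {x | t < f x} * ENNReal.ofReal (t ^ (p - 1)) ≤
      ENNReal.ofReal (D * (p - α)⁻¹ * M ^ p) := by
    have hi : IntervalIntegrable (fun t : ℝ => t ^ (p - 1 - α)) volume 0 M :=
      intervalIntegral.intervalIntegrable_rpow' (by linarith)
    rw [intervalIntegrable_iff_integrableOn_Ioc_of_le hM.le] at hi
    refine (setLIntegral_mono' measurableSet_Ioc fun t ht => hpt α t ht.1 (hlow t ht.1)).trans ?_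
    rw [← ofReal_integral_eq_lintegral_ofReal (hi.const_mul _)]
    · rw [integral_const_mul, ← intervalIntegral.integral_of_le hM.le,
        integral_rpow (.inl (by linarith))]
      apply le_of_eq
      have h1 : p - 1 - α + 1 = p - α := by ring
      rw [h1, Real.zero_rpow (by linarith), Real.rpow_sub hM]
      congr 1
      have : 0 < M ^ α := by positivity
      field_simp
      simp
    · filter_upwards [ae_restrict_mem measurableSet_Ioc] with t ht
      have := ht.1
      positivity
  have hH : ∫⁻ t in Set.Ioi M, ν {x | t < f x} * ENNReal.ofReal (t ^ (p - 1)) ≤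
      ENNReal.ofReal (D * (β - p)⁻¹ * M ^ p) := by
    have hi : IntegrableOn (fun t : ℝ => t ^ (p - 1 - β)) (Set.Ioi M) :=
      integrableOn_Ioi_rpow_of_lt (by linarith) hM
    refine (setLIntegral_mono' measurableSet_Ioi fun t ht =>
      hpt β t (hM.trans ht) (hhigh t (hM.trans ht))).trans ?_
    rw [← ofReal_integral_eq_lintegral_ofReal (hi.const_mul _)]
    · rw [integral_const_mul, integral_Ioi_rpow_of_lt (by linarith) hM]
      apply le_of_eq
      have h1 : p - 1 - β + 1 = p - β := by ring
      rw [h1, Real.rpow_sub hM, ← neg_sub β p]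
      congr 1
      have : 0 < M ^ β := by positivity
      have : β - p ≠ 0 := by linarith
      field_simp
    · filter_upwards [ae_restrict_mem measurableSet_Ioi] with t ht
      have : 0 < t := hM.trans ht
      positivity
  rw [lintegral_rpow_eq_lintegral_meas_lt_mul ν (.of_forall hf0) hf.aemeasurable hp,
    ← Set.Ioc_union_Ioi_eq_Ioi hM.le, mul_assoc, ENNReal.ofReal_mul hp.le]
  gcongr
  refine (lintegral_union_le _ _ _).trans ((add_le_add hL hH).trans_eq ?_)
  have h1 : 0 < (p - α)⁻¹ := inv_pos.2 (by linarith)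
  have h2 : 0 < (β - p)⁻¹ := inv_pos.2 (by linarith)
  rw [← ENNReal.ofReal_add (by positivity) (by positivity)]
  congr 1
  ring

/-- The weighted embedding for `2 ≤ p < 2 (N + σ) / (N - 4)`. -/
theorem exists_lintegral_powerWeight_le {N : ℕ} (hN : 5 ≤ N) {σ p : ℝ} (hσ : -(N : ℝ) < σ)
    (hσ' : σ < 0) (hp : 2 ≤ p) (hp' : p < 2 * ((N : ℝ) + σ) / ((N : ℝ) - 4)) :
    ∃ C > 0, ∀ u : SchwartzMap (EV N) ℂ, 0 < H2n ⇑u →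
      ∫⁻ x, ENNReal.ofReal (‖u x‖ ^ p) ∂(powerWeight N σ) ≤ ENNReal.ofReal (C * H2n ⇑u ^ p) := by
  have hN' : (5 : ℝ) ≤ N := by exact_mod_cast hN
  have hN0 : (N : ℝ) ≠ 0 := by linarith
  have hN4 : (N : ℝ) - 4 ≠ 0 := by linarith
  obtain ⟨K, hK, hweak⟩ := exists_volume_lt_norm_le hN
  obtain ⟨c, hc, hpow⟩ := exists_powerWeight_le (N := N) (by omega) hσ hσ'.le
  set α := 2 * ((N : ℝ) + σ) / N with hαdef
  set β := 2 * ((N : ℝ) + σ) / ((N : ℝ) - 4) with hβdef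
  have hα : α < p := by
    refine lt_of_lt_of_le ?_ hp
    rw [hαdef, div_lt_iff₀ (by linarith)]
    linarith
  have h1 : 0 < (p - α)⁻¹ := inv_pos.2 (by linarith)
  have h2 : 0 < (β - p)⁻¹ := inv_pos.2 (by linarith)
  refine ⟨p * ((c + (K + 1)) * ((p - α)⁻¹ + (β - p)⁻¹)), by positivity, fun u hM => ?_⟩
  have hmeas (t : ℝ) : MeasurableSet {x | t < ‖u x‖} :=
    (isOpen_lt continuous_const u.continuous.norm).measurableSet
  refine lintegral_rpow_le_of_meas_lt_le _ u.continuous.norm.measurable (fun _ => norm_nonneg _)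
    (by linarith) hα hp' (by positivity) hM (fun t ht => ?_) (fun t ht => ?_)
  · have hr : 0 < H2n ⇑u / t := by positivity
    have key := hpow (K + 1) (by positivity) ((H2n ⇑u / t) ^ (2 / (N : ℝ))) (by positivity) _
      (hmeas t) ?_
    · rwa [← Real.rpow_mul hr.le, div_mul_eq_mul_div] at key
    · refine (volume_lt_norm_le u ht).trans (ENNReal.ofReal_le_ofReal ?_)
      have e2 : 2 / (N : ℝ) * N = (2 : ℕ) := by field_simp; norm_num
      rw [← Real.rpow_mul hr.le, e2, Real.rpow_natCast, div_pow, H2n_sq]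
      have h3 : 0 ≤ (massI ⇑u + massI (lap ⇑u)) / t ^ 2 :=
        div_nonneg (add_nonneg (massI_nonneg _) (massI_nonneg _)) (by positivity)
      have h4 : (t ^ 2)⁻¹ * massI ⇑u ≤ (massI ⇑u + massI (lap ⇑u)) / t ^ 2 := by
        rw [div_eq_inv_mul]
        gcongr
        linarith [massI_nonneg (lap ⇑u)]
      change (t ^ 2)⁻¹ * massI ⇑u ≤ _
      nlinarith
  · have hr : 0 < H2n ⇑u / t := by positivity
    have key := hpow (K + 1) (by positivity) ((H2n ⇑u / t) ^ (2 / ((N : ℝ) - 4)))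
      (by positivity) _ (hmeas t) ?_
    · rwa [← Real.rpow_mul hr.le, div_mul_eq_mul_div] at key
    · refine (hweak u hM t ht).trans (ENNReal.ofReal_le_ofReal ?_)
      rw [← Real.rpow_mul hr.le, div_mul_eq_mul_div]
      gcongr
      linarith

/-- A Schwartz function with vanishing `H2n` is zero. -/
theorem eq_zero_of_H2n_eq_zero {N : ℕ} {u : SchwartzMap (EV N) ℂ} (h : H2n ⇑u = 0) (x : EV N) :
    u x = 0 := by
  have h1 := H2n_sq ⇑u
  rw [h] at h1
  have h2 : ∫ x, ‖u x‖ ^ 2 = 0 := by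
    change massI ⇑u = 0
    linarith [massI_nonneg ⇑u, massI_nonneg (lap ⇑u)]
  rw [integral_eq_zero_iff_of_nonneg (fun _ => by positivity) (integrable_norm_sq u)] at h2
  have h3 := Continuous.ae_eq_iff_eq (μ := (volume : Measure (EV N)))
    (by have := u.continuous; fun_prop) continuous_const |>.1 h2
  exact norm_eq_zero.1 (pow_eq_zero_iff two_ne_zero |>.1 (congrFun h3 x))

/-- **Nonlinearity bound (local source term).**
For `N ≥ 5`, `max{-4, -N/2} < 2b < 0` and `3/2 ≤ q < q^*`, there is `C = C(N,q,b) > 0`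
such that `∫ |x|^(2b)|u|^(2q-1) ≤ C ‖u‖_{H²}^(2q-1)` for every Schwartz `u`. -/
theorem stmt9 (N : ℕ) (hN : 5 ≤ N) (b q : ℝ)
    (hb : max (-4) (-(N : ℝ)/2) < 2*b) (hb' : 2*b < 0)
    (hq : 3/2 ≤ q) (hq' : q < 1 + (4 + 2*b)/((N : ℝ) - 4)) :
    ∃ C > 0, ∀ u : SchwartzMap (EV N) ℂ,
      (∫ x : EV N, ‖x‖ ^ (2*b) * ‖u x‖ ^ (2*q - 1)) ≤ C * (H2n ⇑u) ^ (2*q - 1) := by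
  have hN' : (5 : ℝ) ≤ N := by exact_mod_cast hN
  have hb4 : -4 < 2 * b := (le_max_left _ _).trans_lt hb
  have hlt : 2 * q - 1 < 2 * ((N : ℝ) + 2 * b) / ((N : ℝ) - 4) := by
    have h1 : 2 * ((N : ℝ) + 2 * b) / ((N : ℝ) - 4) = 2 * (1 + (4 + 2 * b) / ((N : ℝ) - 4)) := by
      have : (N : ℝ) - 4 ≠ 0 := by linarith
      field_simp
      ring
    rw [h1]
    linarith
  obtain ⟨C, hC, hmain⟩ := exists_lintegral_powerWeight_le hN (σ := 2 * b) (p := 2 * q - 1)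
    (by linarith) hb' (by linarith) hlt
  refine ⟨C, hC, fun u => ?_⟩
  rcases (H2n_nonneg ⇑u).eq_or_lt with h0 | h0
  · rw [← h0, Real.zero_rpow (by linarith)]
    simp [eq_zero_of_H2n_eq_zero h0.symm, Real.zero_rpow (show 2 * q - 1 ≠ 0 by linarith)]
  · have hm1 : Measurable fun x : EV N => ‖x‖ ^ (2 * b) := measurable_norm.pow_const _
    have hm2 : Measurable fun x : EV N => ‖u x‖ ^ (2 * q - 1) :=
      u.continuous.norm.measurable.pow_const _
    rw [integral_eq_lintegral_of_nonneg_ae (.of_forall fun _ => by simp only [Pi.zero_apply]; positivity)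
      (by exact (hm1.mul hm2).aestronglyMeasurable)]
    refine ENNReal.toReal_le_of_le_ofReal (by positivity) (le_trans (le_of_eq ?_) (hmain u h0))
    rw [powerWeight, lintegral_withDensity_eq_lintegral_mul _ hm1.ennreal_ofReal
      hm2.ennreal_ofReal]
    refine lintegral_congr fun x => ?_
    rw [Pi.mul_apply, ENNReal.ofReal_mul (by positivity)]
end
end

section
/- Let T > 0 and let X : [0,T] → [0,∞) be continuous. Suppose X(t) ≤ a + b X(t)^θ for all t ∈ [0,T], where a, b > 0, θ > 1, a < (1 - 1/θ)(θ b)^{1/(1-θ)}, and X(0) ≤ (θ b)^{1/(1-θ)}. Then X(t) ≤ (θ/(θ-1)) a for all t ∈ [0,T]. -/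
/-- Below the threshold `(θb)^(1/(1-θ))` the superlinear term `b x^θ` is at most `x/θ`. -/
theorem mul_rpow_le_div_of_le_threshold {b θ x : ℝ} (hb : 0 < b) (hθ : 1 < θ) (hx : 0 ≤ x)
    (hxM : x ≤ (θ * b) ^ (1/(1 - θ))) : b * x ^ θ ≤ x / θ := by
  have hθ0 : 0 < θ := by linarith
  have hθb : 0 < θ * b := by positivity
  have hexp : 1/(1 - θ) * (θ - 1) = -1 := by
    have : 1 - θ ≠ 0 := by linarith
    field_simp
    ring
  have hpow : x ^ (θ - 1) ≤ (θ * b)⁻¹ := by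
    calc x ^ (θ - 1) ≤ ((θ * b) ^ (1/(1 - θ))) ^ (θ - 1) :=
          Real.rpow_le_rpow hx hxM (by linarith)
      _ = (θ * b)⁻¹ := by rw [← Real.rpow_mul hθb.le, hexp, Real.rpow_neg_one]
  have hsplit : x ^ θ = x ^ (θ - 1) * x := by
    conv_lhs => rw [← sub_add_cancel θ 1]
    rw [Real.rpow_add_one' hx (by linarith)]
  calc b * x ^ θ = b * (x ^ (θ - 1) * x) := by rw [hsplit]
    _ ≤ b * ((θ * b)⁻¹ * x) := by gcongr
    _ = x / θ := by field_simp

/-- **Absorption (bootstrap) lemma.**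
If a continuous nonnegative function `X` on `[0,T]` satisfies `X ≤ a + b X^θ` with
`a, b > 0`, `θ > 1`, `a < (1 - 1/θ)(θb)^(1/(1-θ))` and `X(0) ≤ (θb)^(1/(1-θ))`, then
`X ≤ θa/(θ-1)` on `[0,T]`. -/
theorem stmt15 (T a b θ : ℝ) (hT : 0 < T) (X : ℝ → ℝ)
    (hXc : ContinuousOn X (Set.Icc 0 T))
    (hXnn : ∀ t ∈ Set.Icc (0 : ℝ) T, 0 ≤ X t)
    (ha : 0 < a) (hb : 0 < b) (hθ : 1 < θ)
    (hiter : ∀ t ∈ Set.Icc (0 : ℝ) T, X t ≤ a + b * X t ^ θ)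
    (hsmall : a < (1 - 1/θ) * (θ * b) ^ (1/(1 - θ)))
    (hinit : X 0 ≤ (θ * b) ^ (1/(1 - θ))) :
    ∀ t ∈ Set.Icc (0 : ℝ) T, X t ≤ θ/(θ - 1) * a := by
  have hθ0 : 0 < θ := by linarith
  have hθ1 : 0 < θ - 1 := by linarith
  have hbound : ∀ t ∈ Set.Icc (0 : ℝ) T, X t ≤ (θ * b) ^ (1/(1 - θ)) →
      X t ≤ θ/(θ - 1) * a := by
    intro t ht htM
    have h : X t ≤ a + X t / θ :=
      (hiter t ht).trans (by gcongr; exact mul_rpow_le_div_of_le_threshold hb hθ (hXnn t ht) htM)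
    have hmul : X t * θ ≤ a * θ + X t := by
      calc X t * θ ≤ (a + X t / θ) * θ := by gcongr
        _ = a * θ + X t := by field_simp
    rw [div_mul_eq_mul_div, le_div_iff₀ hθ1]
    linarith
  have hlt : θ/(θ - 1) * a < (θ * b) ^ (1/(1 - θ)) := by
    calc θ/(θ - 1) * a < θ/(θ - 1) * ((1 - 1/θ) * (θ * b) ^ (1/(1 - θ))) := by gcongr
      _ = (θ * b) ^ (1/(1 - θ)) := by
        rw [← mul_assoc, show θ/(θ - 1) * (1 - 1/θ) = 1 by field_simp, one_mul]
  intro t ht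
  refine hbound t ht ?_
  by_contra! hgt
  have hsub : Set.Icc 0 t ⊆ Set.Icc 0 T := Set.Icc_subset_Icc_right ht.2
  obtain ⟨s, hs, hsM⟩ := intermediate_value_Icc ht.1 (hXc.mono hsub) ⟨hinit, hgt.le⟩
  have := hbound s (hsub hs) hsM.le
  linarith
end
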